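/- Let K be a countable index set and λ : K → ℝ a family of real numbers satisfying the uniform gap condition inf{|λ_k − λ_n| : k, n ∈ K, k ≠ n} > 0. Assume there exist a finite subset A₀ ⊆ K and a constant γ₀ > 0 such that |λ_k − λ_n| ≥ γ₀ for all distinct k, n ∈ K ∖ A₀, and let I ⊆ ℝ be a bounded interval of length strictly greater than 2π/γ₀. Then there exist constants A > 0 and B > 0 such that for every finitely supported family of complex coefficients (c_k)_{k ∈ K} one has A·Σ_{k∈K} |c_k|² ≤ ∫_I |Σ_{k∈K} c_k e^{iλ_k t}|² dt ≤ B·Σ_{k∈K} |c_k|². -/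

import Mathlib

open MeasureTheory

/-- The nonharmonic exponential sum `∑ k ∈ s, c k e^{i λ_k t}`. -/
noncomputable def expSum {K : Type*} (lam : K → ℝ) (s : Finset K) (c : K → ℂ) (t : ℝ) : ℂ :=
  ∑ k ∈ s, c k * Complex.exp (Complex.I * (lam k : ℂ) * (t : ℂ))

section

variable {K : Type*} {lam : K → ℝ}

@[fun_prop]
lemma continuous_expSum (lam : K → ℝ) (s : Finset K) (c : K → ℂ) :
    Continuous (expSum lam s c) := by
  unfold expSum
  fun_prop

lemma expSum_add (lam : K → ℝ) (s : Finset K) (c : K → ℂ) (t m : ℝ) :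
    expSum lam s c (t + m) =
      expSum lam s (fun k => c k * Complex.exp (Complex.I * (lam k : ℂ) * (m : ℂ))) t := by
  unfold expSum
  refine Finset.sum_congr rfl fun k _ => ?_
  beta_reduce
  rw [mul_assoc (c k), ← Complex.exp_add]
  push_cast
  ring_nf

lemma norm_exp_I_mul_mul (x t : ℝ) : ‖Complex.exp (Complex.I * (x : ℂ) * (t : ℂ))‖ = 1 := by
  rw [mul_assoc, mul_comm, ← Complex.ofReal_mul, Complex.norm_exp_ofReal_mul_I]

lemma integral_cos_mul_exp {α u : ℝ} (hα : 0 < α) (hu : α ^ 2 - u ^ 2 ≠ 0) :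
    ∫ t in (-(Real.pi / (2 * α)))..(Real.pi / (2 * α)),
      (Real.cos (α * t) : ℂ) * Complex.exp (Complex.I * (u : ℂ) * (t : ℂ)) =
    α * (Complex.exp (Complex.I * (u : ℂ) * ((Real.pi / (2 * α) : ℝ) : ℂ)) +
      Complex.exp (Complex.I * (u : ℂ) * ((-(Real.pi / (2 * α)) : ℝ) : ℂ))) /
      ((α ^ 2 - u ^ 2 : ℝ) : ℂ) := by
  have hu' : ((α ^ 2 - u ^ 2 : ℝ) : ℂ) ≠ 0 := by exact_mod_cast hu
  have hderiv : ∀ t : ℝ, HasDerivAt (fun t : ℝ =>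
      Complex.exp (Complex.I * (u : ℂ) * (t : ℂ)) *
        (α * (Real.sin (α * t) : ℂ) + Complex.I * u * (Real.cos (α * t) : ℂ)) /
        ((α ^ 2 - u ^ 2 : ℝ) : ℂ))
      ((Real.cos (α * t) : ℂ) * Complex.exp (Complex.I * (u : ℂ) * (t : ℂ))) t := by
    intro t
    have h1 : HasDerivAt (fun t : ℝ => Complex.exp (Complex.I * (u : ℂ) * (t : ℂ)))
        (Complex.exp (Complex.I * (u : ℂ) * (t : ℂ)) * (Complex.I * u * 1)) t :=
      ((Complex.ofRealCLM.hasDerivAt (x := t)).const_mul _).cexp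
    have hlin : HasDerivAt (fun t : ℝ => α * t) (α * 1) t := (hasDerivAt_id t).const_mul α
    have h2 := (hlin.sin).ofReal_comp
    have h3 := (hlin.cos).ofReal_comp
    have h4 := (h1.mul ((h2.const_mul (α : ℂ)).add (h3.const_mul (Complex.I * u)))).div_const
      ((α ^ 2 - u ^ 2 : ℝ) : ℂ)
    refine h4.congr_deriv ?_
    rw [div_eq_iff hu']
    push_cast
    simp only [Pi.add_apply]
    linear_combination (Complex.cos (α * t) * Complex.exp (Complex.I * u * t) * u ^ 2) *
      Complex.I_sq
  rw [intervalIntegral.integral_eq_sub_of_hasDerivAt (fun t _ => hderiv t)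
    (by apply Continuous.intervalIntegrable; fun_prop)]
  have e1 : α * (Real.pi / (2 * α)) = Real.pi / 2 := by field_simp
  rw [mul_neg, e1, Real.sin_neg, Real.cos_neg, Real.cos_pi_div_two, Real.sin_pi_div_two]
  push_cast
  ring

lemma norm_integral_cos_mul_exp_le {α u : ℝ} (hα : 0 < α) (hu : α ^ 2 < u ^ 2) :
    ‖∫ t in (-(Real.pi / (2 * α)))..(Real.pi / (2 * α)),
      (Real.cos (α * t) : ℂ) * Complex.exp (Complex.I * (u : ℂ) * (t : ℂ))‖ ≤
    2 * α / (u ^ 2 - α ^ 2) := by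
  rw [integral_cos_mul_exp hα (by linarith), norm_div, norm_mul, Complex.norm_real,
    Complex.norm_real, Real.norm_of_nonneg hα.le, Real.norm_of_nonpos (by linarith), neg_sub]
  have h := norm_add_le (Complex.exp (Complex.I * (u : ℂ) * ((Real.pi / (2 * α) : ℝ) : ℂ)))
    (Complex.exp (Complex.I * (u : ℂ) * ((-(Real.pi / (2 * α)) : ℝ) : ℂ)))
  rw [norm_exp_I_mul_mul, norm_exp_I_mul_mul] at h
  refine div_le_div_of_nonneg_right ?_ (by linarith)
  nlinarith

lemma integral_cos_mul_const {α : ℝ} (hα : 0 < α) :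
    ∫ t in (-(Real.pi / (2 * α)))..(Real.pi / (2 * α)), (Real.cos (α * t) : ℂ) =
      ((2 / α : ℝ) : ℂ) := by
  have h := integral_cos_mul_exp (u := 0) hα (by simpa using hα.ne')
  simp only [Complex.ofReal_zero, mul_zero, zero_mul, Complex.exp_zero, mul_one] at h
  rw [h]
  have : (α : ℂ) ≠ 0 := by exact_mod_cast hα.ne'
  push_cast
  field_simp
  ring

lemma sum_range_inv_four_mul_sq_sub_one_le (N : ℕ) :
    ∑ r ∈ Finset.range N, 1 / (4 * ((r : ℝ) + 1) ^ 2 - 1) ≤ 1 / 2 := by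
  suffices h : ∑ r ∈ Finset.range N, 1 / (4 * ((r : ℝ) + 1) ^ 2 - 1) =
      1 / 2 * (1 - 1 / (2 * (N : ℝ) + 1)) by
    rw [h]
    have : (0 : ℝ) ≤ 1 / (2 * (N : ℝ) + 1) := by positivity
    linarith
  induction N with
  | zero => simp
  | succ n ih =>
    rw [Finset.sum_range_succ, ih]
    have h1 : (2 * (n : ℝ) + 1) ≠ 0 := by positivity
    have h2 : (2 * ((n : ℝ) + 1) + 1) ≠ 0 := by positivity
    have h3 : 4 * ((n : ℝ) + 1) ^ 2 - 1 = (2 * n + 1) * (2 * (n + 1) + 1) := by ring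
    rw [h3]
    push_cast
    field_simp
    ring

lemma sum_kernel_pos_le {α γ x : ℝ} (hα : 0 < α) (hαγ : 2 * α < γ) (s : Finset K)
    (hpos : ∀ k ∈ s, γ ≤ lam k - x)
    (hgap : ∀ k ∈ s, ∀ n ∈ s, k ≠ n → γ ≤ |lam k - lam n|) :
    ∑ k ∈ s, 2 * α / ((lam k - x) ^ 2 - α ^ 2) ≤ 4 * α / γ ^ 2 := by
  have hγ : 0 < γ := by linarith
  set φ : K → ℕ := fun k => ⌊(lam k - x) / γ - 1⌋₊ with hφ
  have hnn : ∀ k ∈ s, 0 ≤ (lam k - x) / γ - 1 := fun k hk => by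
    have := (one_le_div hγ).2 (hpos k hk)
    linarith
  have hle : ∀ k ∈ s, γ * ((φ k : ℝ) + 1) ≤ lam k - x := fun k hk => by
    have h := Nat.floor_le (hnn k hk)
    have h' : (φ k : ℝ) + 1 ≤ (lam k - x) / γ := by
      simp only [hφ]; linarith
    rw [le_div_iff₀ hγ] at h'
    linarith
  have hlt : ∀ k ∈ s, lam k - x < γ * ((φ k : ℝ) + 2) := fun k hk => by
    have h := Nat.lt_floor_add_one ((lam k - x) / γ - 1)
    have h' : (lam k - x) / γ < (φ k : ℝ) + 2 := by
      simp only [hφ]; linarith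
    rw [div_lt_iff₀ hγ] at h'
    linarith
  have hinj : Set.InjOn φ s := by
    intro k hk n hn hkn
    by_contra hne
    have h1 := hgap k hk n hn hne
    have h2 := hle k hk
    have h3 := hlt k hk
    have h4 := hle n hn
    have h5 := hlt n hn
    rw [hkn] at h2 h3
    have : |lam k - lam n| < γ := abs_lt.2 ⟨by linarith, by linarith⟩
    linarith
  have hterm : ∀ k ∈ s, 2 * α / ((lam k - x) ^ 2 - α ^ 2) ≤
      8 * α / γ ^ 2 * (1 / (4 * ((φ k : ℝ) + 1) ^ 2 - 1)) := fun k hk => by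
    have h1 : (0 : ℝ) < 4 * ((φ k : ℝ) + 1) ^ 2 - 1 := by
      have : (0 : ℝ) ≤ φ k := by positivity
      nlinarith
    have h2 : γ ^ 2 * (4 * ((φ k : ℝ) + 1) ^ 2 - 1) / 4 ≤ (lam k - x) ^ 2 - α ^ 2 := by
      have h3 : (γ * ((φ k : ℝ) + 1)) ^ 2 ≤ (lam k - x) ^ 2 := by
        gcongr
        exact hle k hk
      nlinarith
    calc 2 * α / ((lam k - x) ^ 2 - α ^ 2)
        ≤ 2 * α / (γ ^ 2 * (4 * ((φ k : ℝ) + 1) ^ 2 - 1) / 4) := by gcongr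
      _ = _ := by field_simp; ring
  have himg : s.image φ ⊆ Finset.range ((s.image φ).sup id + 1) := fun r hr =>
    Finset.mem_range.2 (Nat.lt_succ_of_le (Finset.le_sup (f := id) hr))
  calc ∑ k ∈ s, 2 * α / ((lam k - x) ^ 2 - α ^ 2)
      ≤ ∑ k ∈ s, 8 * α / γ ^ 2 * (1 / (4 * ((φ k : ℝ) + 1) ^ 2 - 1)) := Finset.sum_le_sum hterm
    _ = 8 * α / γ ^ 2 * ∑ r ∈ s.image φ, 1 / (4 * ((r : ℝ) + 1) ^ 2 - 1) := by
      rw [Finset.sum_image hinj, Finset.mul_sum]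
    _ ≤ 8 * α / γ ^ 2 * ∑ r ∈ Finset.range ((s.image φ).sup id + 1),
          1 / (4 * ((r : ℝ) + 1) ^ 2 - 1) := by
      refine mul_le_mul_of_nonneg_left
        (Finset.sum_le_sum_of_subset_of_nonneg himg fun r _ _ => ?_) (by positivity)
      refine one_div_nonneg.2 ?_
      have : (0 : ℝ) ≤ r := by positivity
      nlinarith
    _ ≤ 8 * α / γ ^ 2 * (1 / 2) := by
      gcongr
      exact sum_range_inv_four_mul_sq_sub_one_le _
    _ = 4 * α / γ ^ 2 := by ring

lemma sum_kernel_le {α γ x : ℝ} (hα : 0 < α) (hαγ : 2 * α < γ) (s : Finset K)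
    (hx : ∀ k ∈ s, γ ≤ |lam k - x|)
    (hgap : ∀ k ∈ s, ∀ n ∈ s, k ≠ n → γ ≤ |lam k - lam n|) :
    ∑ k ∈ s, 2 * α / ((lam k - x) ^ 2 - α ^ 2) ≤ 8 * α / γ ^ 2 := by
  rw [← Finset.sum_filter_add_sum_filter_not s (fun k => x ≤ lam k)]
  have h1 : ∑ k ∈ s with x ≤ lam k, 2 * α / ((lam k - x) ^ 2 - α ^ 2) ≤ 4 * α / γ ^ 2 := by
    refine sum_kernel_pos_le hα hαγ _ (fun k hk => ?_) fun k hk n hn =>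
      hgap k (Finset.mem_filter.1 hk).1 n (Finset.mem_filter.1 hn).1
    rw [Finset.mem_filter] at hk
    have := hx k hk.1
    rwa [abs_of_nonneg (by linarith)] at this
  have h2 : ∑ k ∈ s with ¬ x ≤ lam k, 2 * α / ((lam k - x) ^ 2 - α ^ 2) ≤ 4 * α / γ ^ 2 := by
    have h3 := sum_kernel_pos_le (lam := fun k => -lam k) (x := -x) hα hαγ
      (s.filter fun k => ¬ x ≤ lam k) (fun k hk => ?_) fun k hk n hn hkn => ?_
    · convert h3 using 4
      ring
    · rw [Finset.mem_filter] at hk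
      have := hx k hk.1
      rw [abs_of_neg (by linarith)] at this
      linarith
    · rw [neg_sub_neg, abs_sub_comm]
      exact hgap k (Finset.mem_filter.1 hk).1 n (Finset.mem_filter.1 hn).1 hkn
  linarith [show 8 * α / γ ^ 2 = 4 * α / γ ^ 2 + 4 * α / γ ^ 2 by ring]

lemma ofReal_norm_expSum_sq (s : Finset K) (c : K → ℂ) (t : ℝ) :
    ((‖expSum lam s c t‖ ^ 2 : ℝ) : ℂ) = ∑ m ∈ s, ∑ n ∈ s, c m * (starRingEnd ℂ) (c n) *
      Complex.exp (Complex.I * ((lam m - lam n : ℝ) : ℂ) * (t : ℂ)) := by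
  rw [Complex.ofReal_pow, ← Complex.mul_conj']
  unfold expSum
  rw [map_sum, Finset.sum_mul_sum]
  refine Finset.sum_congr rfl fun m _ => Finset.sum_congr rfl fun n _ => ?_
  rw [map_mul, ← Complex.exp_conj, mul_mul_mul_comm, ← Complex.exp_add]
  simp only [map_mul, Complex.conj_I, Complex.conj_ofReal]
  push_cast
  ring_nf

/-- The weighted form of Ingham's inequality. -/
lemma abs_integral_cos_mul_norm_sq_sub_le {α γ : ℝ} (hα : 0 < α) (hαγ : 2 * α < γ)
    (s : Finset K) (hgap : ∀ k ∈ s, ∀ n ∈ s, k ≠ n → γ ≤ |lam k - lam n|) (c : K → ℂ) :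
    |(∫ t in (-(Real.pi / (2 * α)))..(Real.pi / (2 * α)),
        Real.cos (α * t) * ‖expSum lam s c t‖ ^ 2) - 2 / α * ∑ k ∈ s, ‖c k‖ ^ 2| ≤
      8 * α / γ ^ 2 * ∑ k ∈ s, ‖c k‖ ^ 2 := by
  classical
  set J : ℝ → ℂ := fun u => ∫ t in (-(Real.pi / (2 * α)))..(Real.pi / (2 * α)),
      (Real.cos (α * t) : ℂ) * Complex.exp (Complex.I * (u : ℂ) * (t : ℂ)) with hJ
  have hJ0 : J 0 = ((2 / α : ℝ) : ℂ) := by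
    simp only [hJ, Complex.ofReal_zero, mul_zero, zero_mul, Complex.exp_zero, mul_one]
    exact integral_cos_mul_const hα
  have hint : ((∫ t in (-(Real.pi / (2 * α)))..(Real.pi / (2 * α)),
        Real.cos (α * t) * ‖expSum lam s c t‖ ^ 2 : ℝ) : ℂ) =
      ∑ m ∈ s, ∑ n ∈ s, c m * (starRingEnd ℂ) (c n) * J (lam m - lam n) := by
    rw [← intervalIntegral.integral_ofReal]
    simp only [Complex.ofReal_mul, ofReal_norm_expSum_sq, Finset.mul_sum, hJ]
    rw [intervalIntegral.integral_finsetSum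
      (fun m _ => by apply Continuous.intervalIntegrable; fun_prop)]
    refine Finset.sum_congr rfl fun m _ => ?_
    rw [intervalIntegral.integral_finsetSum
      (fun m _ => by apply Continuous.intervalIntegrable; fun_prop)]
    refine Finset.sum_congr rfl fun n _ => ?_
    rw [← intervalIntegral.integral_const_mul]
    congr 1
    ext t
    ring
  have hsplit : (((∫ t in (-(Real.pi / (2 * α)))..(Real.pi / (2 * α)),
        Real.cos (α * t) * ‖expSum lam s c t‖ ^ 2) - 2 / α * ∑ k ∈ s, ‖c k‖ ^ 2 : ℝ) : ℂ) =
      ∑ m ∈ s, ∑ n ∈ s.erase m, c m * (starRingEnd ℂ) (c n) * J (lam m - lam n) := by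
    rw [Complex.ofReal_sub, hint, sub_eq_iff_eq_add, Complex.ofReal_mul, ← hJ0,
      Complex.ofReal_sum, Finset.mul_sum, ← Finset.sum_add_distrib]
    refine Finset.sum_congr rfl fun m hm => ?_
    rw [← Finset.sum_erase_add s _ hm, sub_self, Complex.mul_conj', Complex.ofReal_pow,
      mul_comm (J 0)]
  set κ : K → K → ℝ := fun m n => 2 * α / ((lam m - lam n) ^ 2 - α ^ 2) with hκ
  have hκJ : ∀ m ∈ s, ∀ n ∈ s.erase m, ‖J (lam m - lam n)‖ ≤ κ m n := fun m hm n hn => by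
    refine norm_integral_cos_mul_exp_le hα ?_
    rw [Finset.mem_erase] at hn
    rw [← sq_abs (lam m - lam n)]
    have := hgap m hm n hn.2 hn.1.symm
    gcongr
    linarith
  have hκs : ∀ m n, κ m n = κ n m := fun m n => by
    simp only [hκ]
    rw [← neg_sub (lam n), neg_sq]
  have hrow : ∀ m ∈ s, ∑ n ∈ s.erase m, κ m n ≤ 8 * α / γ ^ 2 := fun m hm => by
    simp only [hκs m]
    refine sum_kernel_le hα hαγ _ (fun n hn => ?_) fun k hk n hn => ?_
    · rw [Finset.mem_erase] at hn
      exact hgap n hn.2 m hm hn.1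
    · exact hgap k (Finset.mem_of_mem_erase hk) n (Finset.mem_of_mem_erase hn)
  have hswap : ∑ m ∈ s, ∑ n ∈ s.erase m, κ m n * ‖c n‖ ^ 2 =
      ∑ m ∈ s, ∑ n ∈ s.erase m, κ m n * ‖c m‖ ^ 2 := by
    rw [Finset.sum_comm' (t' := s) (s' := fun n => s.erase n)
      (by intro x y; simp only [Finset.mem_erase]; tauto)]
    refine Finset.sum_congr rfl fun m _ => Finset.sum_congr rfl fun n _ => ?_
    rw [hκs]
  rw [← Real.norm_eq_abs, ← Complex.norm_real, hsplit]
  calc ‖∑ m ∈ s, ∑ n ∈ s.erase m, c m * (starRingEnd ℂ) (c n) * J (lam m - lam n)‖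
      ≤ ∑ m ∈ s, ∑ n ∈ s.erase m, ‖c m * (starRingEnd ℂ) (c n) * J (lam m - lam n)‖ :=
        (norm_sum_le _ _).trans (Finset.sum_le_sum fun m _ => norm_sum_le _ _)
    _ ≤ ∑ m ∈ s, ∑ n ∈ s.erase m,
          (1 / 2 * (κ m n * ‖c m‖ ^ 2) + 1 / 2 * (κ m n * ‖c n‖ ^ 2)) := by
      refine Finset.sum_le_sum fun m hm => Finset.sum_le_sum fun n hn => ?_
      have h1 := hκJ m hm n hn
      have h2 : 0 ≤ κ m n := (norm_nonneg _).trans h1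
      rw [norm_mul, norm_mul, RCLike.norm_conj]
      calc ‖c m‖ * ‖c n‖ * ‖J (lam m - lam n)‖ ≤ ‖c m‖ * ‖c n‖ * κ m n := by gcongr
        _ ≤ _ := by nlinarith [mul_nonneg h2 (sq_nonneg (‖c m‖ - ‖c n‖))]
    _ = ∑ m ∈ s, ‖c m‖ ^ 2 * ∑ n ∈ s.erase m, κ m n := by
      simp only [Finset.sum_add_distrib, ← Finset.mul_sum]
      rw [hswap]
      simp only [Finset.mul_sum, ← Finset.sum_add_distrib]
      refine Finset.sum_congr rfl fun m _ => Finset.sum_congr rfl fun n _ => ?_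
      ring
    _ ≤ ∑ m ∈ s, ‖c m‖ ^ 2 * (8 * α / γ ^ 2) := by
      gcongr with m hm
      exact hrow m hm
    _ = _ := by rw [← Finset.sum_mul, mul_comm]

/-- The direct inequality, valid on every bounded interval. -/
lemma exists_integral_norm_expSum_sq_le {γ : ℝ} (hγ : 0 < γ)
    (hgap : ∀ k n : K, k ≠ n → γ ≤ |lam k - lam n|) {a b : ℝ} (hab : a ≤ b) :
    ∃ B > (0 : ℝ), ∀ (s : Finset K) (c : K → ℂ),
      ∫ t in a..b, ‖expSum lam s c t‖ ^ 2 ≤ B * ∑ k ∈ s, ‖c k‖ ^ 2 := by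
  set M : ℝ := |a| + |b| + 1 with hM
  have hM0 : 0 < M := by positivity
  set α : ℝ := min (γ / 4) (1 / M) with hα'
  have hα : 0 < α := by positivity
  have hαγ : 2 * α < γ := by
    have : α ≤ γ / 4 := min_le_left _ _
    linarith
  have hαM : α * M ≤ 1 := by
    have : α ≤ 1 / M := min_le_right _ _
    rwa [le_div_iff₀ hM0] at this
  have hMT : M ≤ Real.pi / (2 * α) := by
    rw [le_div_iff₀ (by positivity)]
    linarith [Real.pi_gt_three]
  refine ⟨2 * (2 / α + 8 * α / γ ^ 2), by positivity, fun s c => ?_⟩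
  have hw := (abs_le.1 (abs_integral_cos_mul_norm_sq_sub_le (lam := lam) hα hαγ s
    (fun k _ n _ => hgap k n) c)).2
  have haM : -M ≤ a := by linarith [neg_abs_le a, abs_nonneg b]
  have hbM : b ≤ M := by linarith [le_abs_self b, abs_nonneg a]
  have h1 : ∫ t in a..b, ‖expSum lam s c t‖ ^ 2 ≤
      ∫ t in a..b, 2 * (Real.cos (α * t) * ‖expSum lam s c t‖ ^ 2) := by
    refine intervalIntegral.integral_mono_on hab
      (by apply Continuous.intervalIntegrable; fun_prop)
      (by apply Continuous.intervalIntegrable; fun_prop) fun t ht => ?_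
    have ht1 : |α * t| ≤ 1 := by
      rw [abs_mul, abs_of_pos hα]
      refine le_trans ?_ hαM
      gcongr
      exact abs_le.2 ⟨by linarith [ht.1], by linarith [ht.2]⟩
    have hcos : 1 / 2 ≤ Real.cos (α * t) := by
      have h := Real.one_sub_sq_div_two_le_cos (x := α * t)
      have : (α * t) ^ 2 ≤ 1 := (sq_le_one_iff_abs_le_one _).2 ht1
      linarith
    nlinarith [sq_nonneg ‖expSum lam s c t‖]
  have h2 : ∫ t in a..b, 2 * (Real.cos (α * t) * ‖expSum lam s c t‖ ^ 2) ≤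
      ∫ t in (-(Real.pi / (2 * α)))..(Real.pi / (2 * α)),
        2 * (Real.cos (α * t) * ‖expSum lam s c t‖ ^ 2) := by
    refine intervalIntegral.integral_mono_interval (by linarith) hab (by linarith) ?_
      (by apply Continuous.intervalIntegrable; fun_prop)
    refine (ae_restrict_iff' measurableSet_Ioc).2 (Filter.Eventually.of_forall fun t ht => ?_)
    have hcos : 0 ≤ Real.cos (α * t) := by
      have e1 : α * (Real.pi / (2 * α)) = Real.pi / 2 := by field_simp
      refine Real.cos_nonneg_of_neg_pi_div_two_le_of_le ?_ ?_
      · rw [← e1, ← mul_neg]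
        exact mul_le_mul_of_nonneg_left ht.1.le hα.le
      · rw [← e1]
        exact mul_le_mul_of_nonneg_left ht.2 hα.le
    simp only [Pi.zero_apply]
    positivity
  rw [intervalIntegral.integral_const_mul (a := -(Real.pi / (2 * α)))] at h2
  linarith

/-- Ingham's inverse inequality. -/
lemma exists_le_integral_norm_expSum_sq {S : Set K} {γ : ℝ} (hγ : 0 < γ)
    (hgap : ∀ k ∈ S, ∀ n ∈ S, k ≠ n → γ ≤ |lam k - lam n|) {a b : ℝ}
    (hab : 2 * Real.pi / γ < b - a) :
    ∃ A > (0 : ℝ), ∀ (s : Finset K), ↑s ⊆ S → ∀ c : K → ℂ,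
      A * ∑ k ∈ s, ‖c k‖ ^ 2 ≤ ∫ t in a..b, ‖expSum lam s c t‖ ^ 2 := by
  have hba : 0 < b - a := lt_trans (by positivity) hab
  set α : ℝ := Real.pi / (b - a) with hα'
  have hα : 0 < α := by positivity
  have hαγ : 2 * α < γ := by
    rw [div_lt_iff₀ hγ] at hab
    rw [hα', mul_div_assoc', div_lt_iff₀ hba]
    linarith
  have hT : Real.pi / (2 * α) = (b - a) / 2 := by
    rw [hα']
    field_simp
  refine ⟨2 / α - 8 * α / γ ^ 2, ?_, fun s hs c => ?_⟩
  · rw [gt_iff_lt, sub_pos, div_lt_div_iff₀ (by positivity) hα]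
    nlinarith
  set d : K → ℂ := fun k =>
    c k * Complex.exp (Complex.I * (lam k : ℂ) * (((a + b) / 2 : ℝ) : ℂ)) with hd
  have hdc : ∀ k, ‖d k‖ = ‖c k‖ := fun k => by rw [hd, norm_mul, norm_exp_I_mul_mul, mul_one]
  have hw := (abs_le.1 (abs_integral_cos_mul_norm_sq_sub_le (lam := lam) hα hαγ s
    (fun k hk n hn => hgap k (hs hk) n (hs hn)) d)).1
  simp only [hdc] at hw
  have h1 : ∫ t in a..b, ‖expSum lam s c t‖ ^ 2 =
      ∫ t in (-(Real.pi / (2 * α)))..(Real.pi / (2 * α)), ‖expSum lam s d t‖ ^ 2 := by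
    simp only [hd, ← expSum_add]
    rw [intervalIntegral.integral_comp_add_right (fun t => ‖expSum lam s c t‖ ^ 2), hT]
    congr 1 <;> ring
  have h2 : ∫ t in (-(Real.pi / (2 * α)))..(Real.pi / (2 * α)),
        Real.cos (α * t) * ‖expSum lam s d t‖ ^ 2 ≤
      ∫ t in (-(Real.pi / (2 * α)))..(Real.pi / (2 * α)), ‖expSum lam s d t‖ ^ 2 := by
    refine intervalIntegral.integral_mono_on (by rw [hT]; linarith)
      (by apply Continuous.intervalIntegrable; fun_prop)
      (by apply Continuous.intervalIntegrable; fun_prop) fun t _ => ?_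
    exact mul_le_of_le_one_left (by positivity) (Real.cos_le_one _)
  rw [h1]
  linarith
lemma integral_exp_I_mul_mul (x δ : ℝ) :
    ∫ r in (-δ)..δ, Complex.exp (Complex.I * (x : ℂ) * (r : ℂ)) =
      2 * δ * (Real.sinc (x * δ) : ℂ) := by
  rcases eq_or_ne x 0 with rfl | hx
  · simp
    ring
  · have h := intervalIntegral.smul_integral_comp_mul_left (a := -δ) (b := δ)
      (fun t : ℝ => Complex.exp (t * Complex.I)) x
    rw [mul_neg, integral_exp_mul_I_eq_sinc, Complex.real_smul] at h
    have hx' : (x : ℂ) ≠ 0 := by exact_mod_cast hx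
    apply mul_left_cancel₀ hx'
    calc _ = (x : ℂ) * ∫ r in (-δ)..δ, Complex.exp (((x * r : ℝ) : ℂ) * Complex.I) := by
          congr 2
          ext r
          push_cast
          ring_nf
      _ = _ := by
          rw [h]
          push_cast
          ring

lemma exists_pos_le_one_sub_sinc {x₀ : ℝ} (hx₀ : 0 < x₀) :
    ∃ ε > (0 : ℝ), ∀ x : ℝ, x₀ ≤ |x| → ε ≤ 1 - Real.sinc x := by
  have habs : ∀ x : ℝ, Real.sinc |x| = Real.sinc x := fun x => by
    rcases abs_choice x with h | h <;> rw [h]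
    exact Real.sinc_neg x
  obtain ⟨y, hy, hmin⟩ := (isCompact_Icc (a := x₀) (b := max x₀ 2)).exists_isMinOn
    ⟨x₀, le_rfl, le_max_left _ _⟩ (f := fun x => 1 - Real.sinc x)
    (continuous_const.sub Real.continuous_sinc).continuousOn
  have hy0 : 0 < y := hx₀.trans_le hy.1
  have hpos : 0 < 1 - Real.sinc y := by
    rw [sub_pos, Real.sinc_of_ne_zero hy0.ne', div_lt_one hy0]
    exact Real.sin_lt hy0
  refine ⟨min (1 - Real.sinc y) (1 / 2), by positivity, fun x hx => ?_⟩
  rw [← habs x]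
  rcases le_total |x| (max x₀ 2) with h | h
  · exact (min_le_left _ _).trans (hmin ⟨hx, h⟩)
  · refine (min_le_right _ _).trans ?_
    have h2 : (2 : ℝ) ≤ |x| := (le_max_right _ _).trans h
    have h3 := Real.sinc_le_inv_abs (x := |x|) (by positivity)
    rw [abs_abs] at h3
    have h4 : |x|⁻¹ ≤ 2⁻¹ := by gcongr
    linarith

lemma sq_intervalIntegral_le {φ : ℝ → ℝ} (hφ : Continuous φ) {p q : ℝ} (hpq : p < q) :
    (∫ t in p..q, φ t) ^ 2 ≤ (q - p) * ∫ t in p..q, φ t ^ 2 := by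
  set m : ℝ := ∫ t in p..q, φ t with hm
  have h : 0 ≤ ∫ t in p..q, ((q - p) * φ t - m) ^ 2 :=
    intervalIntegral.integral_nonneg hpq.le fun t _ => sq_nonneg _
  have he : ∫ t in p..q, ((q - p) * φ t - m) ^ 2 =
      (q - p) ^ 2 * (∫ t in p..q, φ t ^ 2) - 2 * (q - p) * m * m + (q - p) * m ^ 2 := by
    calc _ = ∫ t in p..q, ((q - p) ^ 2 * φ t ^ 2 - 2 * (q - p) * m * φ t + m ^ 2) := by
          congr 1
          ext t
          ring
      _ = _ := by
          rw [intervalIntegral.integral_add (by apply Continuous.intervalIntegrable; fun_prop)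
            (by apply Continuous.intervalIntegrable; fun_prop),
            intervalIntegral.integral_sub (by apply Continuous.intervalIntegrable; fun_prop)
            (by apply Continuous.intervalIntegrable; fun_prop),
            intervalIntegral.integral_const_mul, intervalIntegral.integral_const_mul,
            intervalIntegral.integral_const, smul_eq_mul, ← hm]
  rw [he] at h
  have : 0 ≤ (q - p) * ((q - p) * (∫ t in p..q, φ t ^ 2) - m ^ 2) := by nlinarith
  have := nonneg_of_mul_nonneg_right this (sub_pos.2 hpq)
  linarith

/-- Subtracting a modulated average from an exponential sum acts diagonally on the coefficients. -/
lemma expSum_sub_average (s : Finset K) (c : K → ℂ) (μ t : ℝ) {δ : ℝ} (hδ : 0 < δ) :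
    expSum lam s (fun k => c k * ((1 - Real.sinc ((lam k - μ) * δ) : ℝ) : ℂ)) t =
      expSum lam s c t - (2 * δ : ℂ)⁻¹ *
        ∫ r in (-δ)..δ, Complex.exp (Complex.I * ((-μ : ℝ) : ℂ) * (r : ℂ)) *
          expSum lam s c (t + r) := by
  have hδ' : (δ : ℂ) ≠ 0 := by exact_mod_cast hδ.ne'
  have hterm : ∀ k, ∫ r in (-δ)..δ, Complex.exp (Complex.I * ((-μ : ℝ) : ℂ) * (r : ℂ)) *
      (c k * Complex.exp (Complex.I * (lam k : ℂ) * ((t + r : ℝ) : ℂ))) =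
      c k * Complex.exp (Complex.I * (lam k : ℂ) * (t : ℂ)) *
        (2 * δ * (Real.sinc ((lam k - μ) * δ) : ℂ)) := fun k => by
    rw [← integral_exp_I_mul_mul, ← intervalIntegral.integral_const_mul]
    congr 1
    ext r
    rw [mul_left_comm, ← Complex.exp_add, mul_assoc (c k), ← Complex.exp_add]
    push_cast
    ring_nf
  unfold expSum
  simp only [Finset.mul_sum]
  rw [intervalIntegral.integral_finsetSum
    (fun m _ => by apply Continuous.intervalIntegrable; fun_prop), Finset.mul_sum,
    ← Finset.sum_sub_distrib]
  refine Finset.sum_congr rfl fun k _ => ?_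
  rw [hterm]
  push_cast
  field_simp

lemma integral_norm_average_sub_sq_le (s : Finset K) (c : K → ℂ) (μ : ℝ) {a b δ : ℝ}
    (hδ : 0 < δ) (hab : a + δ ≤ b - δ) :
    ∫ t in (a + δ)..(b - δ),
      ‖expSum lam s (fun k => c k * ((1 - Real.sinc ((lam k - μ) * δ) : ℝ) : ℂ)) t‖ ^ 2 ≤
      (2 + (b - a) / δ) * ∫ t in a..b, ‖expSum lam s c t‖ ^ 2 := by
  set F : ℝ := ∫ t in a..b, ‖expSum lam s c t‖ ^ 2 with hF
  have hsub : ∀ p q : ℝ, a ≤ p → p ≤ q → q ≤ b →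
      ∫ t in p..q, ‖expSum lam s c t‖ ^ 2 ≤ F := fun p q hp hpq hq =>
    intervalIntegral.integral_mono_interval hp hpq hq
      (Filter.Eventually.of_forall fun t => by simp only [Pi.zero_apply]; positivity)
      (by apply Continuous.intervalIntegrable; fun_prop)
  have hF0 : 0 ≤ F := intervalIntegral.integral_nonneg (by linarith) fun t _ => by positivity
  have hpt : ∀ t ∈ Set.Icc (a + δ) (b - δ),
      ‖expSum lam s (fun k => c k * ((1 - Real.sinc ((lam k - μ) * δ) : ℝ) : ℂ)) t‖ ^ 2 ≤
        2 * ‖expSum lam s c t‖ ^ 2 + F / δ := fun t ht => by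
    set W : ℂ := ∫ r in (-δ)..δ, Complex.exp (Complex.I * ((-μ : ℝ) : ℂ) * (r : ℂ)) *
          expSum lam s c (t + r) with hW
    have hW1 : ‖W‖ ≤ ∫ r in (-δ)..δ, ‖expSum lam s c (t + r)‖ := by
      refine (intervalIntegral.norm_integral_le_integral_norm (by linarith)).trans_eq ?_
      simp only [norm_mul, norm_exp_I_mul_mul, one_mul]
    have hW2 : ‖W‖ ^ 2 ≤ 2 * δ * F := by
      calc ‖W‖ ^ 2 ≤ (∫ r in (-δ)..δ, ‖expSum lam s c (t + r)‖) ^ 2 := by gcongr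
        _ ≤ (δ - -δ) * ∫ r in (-δ)..δ, ‖expSum lam s c (t + r)‖ ^ 2 :=
          sq_intervalIntegral_le (by fun_prop) (by linarith)
        _ = 2 * δ * ∫ r in (t + -δ)..(t + δ), ‖expSum lam s c r‖ ^ 2 := by
          rw [intervalIntegral.integral_comp_add_left (fun r => ‖expSum lam s c r‖ ^ 2)]
          ring
        _ ≤ 2 * δ * F := by
          gcongr
          exact hsub _ _ (by linarith [ht.1]) (by linarith) (by linarith [ht.2])
    rw [expSum_sub_average s c μ t hδ, ← hW]
    have h1 := norm_sub_le (expSum lam s c t) ((2 * δ : ℂ)⁻¹ * W)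
    have h2 : ‖(2 * δ : ℂ)⁻¹ * W‖ ^ 2 ≤ F / δ / 2 := by
      have : ‖(2 * δ : ℂ)⁻¹‖ = (2 * δ)⁻¹ := by
        rw [norm_inv, norm_mul, Complex.norm_real, Real.norm_of_nonneg hδ.le]
        simp
      rw [norm_mul, this, mul_pow]
      calc (2 * δ)⁻¹ ^ 2 * ‖W‖ ^ 2 ≤ (2 * δ)⁻¹ ^ 2 * (2 * δ * F) := by gcongr
        _ = F / δ / 2 := by field_simp
    calc ‖expSum lam s c t - (2 * δ : ℂ)⁻¹ * W‖ ^ 2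
        ≤ (‖expSum lam s c t‖ + ‖(2 * δ : ℂ)⁻¹ * W‖) ^ 2 := by gcongr
      _ ≤ 2 * (‖expSum lam s c t‖ ^ 2 + ‖(2 * δ : ℂ)⁻¹ * W‖ ^ 2) := add_sq_le
      _ ≤ _ := by linarith
  calc _ ≤ ∫ t in (a + δ)..(b - δ), (2 * ‖expSum lam s c t‖ ^ 2 + F / δ) :=
        intervalIntegral.integral_mono_on hab
          (by apply Continuous.intervalIntegrable; fun_prop)
          (by apply Continuous.intervalIntegrable; fun_prop) hpt
    _ = 2 * (∫ t in (a + δ)..(b - δ), ‖expSum lam s c t‖ ^ 2) + (b - δ - (a + δ)) * (F / δ) := by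
      rw [intervalIntegral.integral_add (by apply Continuous.intervalIntegrable; fun_prop)
        (by apply Continuous.intervalIntegrable; fun_prop), intervalIntegral.integral_const_mul,
        intervalIntegral.integral_const, smul_eq_mul]
    _ ≤ 2 * F + (b - a) * (F / δ) := by
      have := hsub (a + δ) (b - δ) (by linarith) hab (by linarith)
      gcongr <;> linarith
    _ = _ := by ring

/-- The lower frame inequality for exponents indexed by `S`, on every interval longer than `L`. -/
def LowerIngham {K : Type*} (lam : K → ℝ) (L : ℝ) (S : Set K) : Prop :=
  ∀ a b : ℝ, L < b - a → ∃ A > (0 : ℝ), ∀ s : Finset K, ↑s ⊆ S → ∀ c : K → ℂ,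
    A * ∑ k ∈ s, ‖c k‖ ^ 2 ≤ ∫ t in a..b, ‖expSum lam s c t‖ ^ 2

/-- Haraux's lemma: one exponent may be added without enlarging the critical length. -/
lemma LowerIngham.insert {γ L : ℝ} (hγ : 0 < γ) (hL : 0 ≤ L)
    (hgap : ∀ k n : K, k ≠ n → γ ≤ |lam k - lam n|) {S : Set K} (hS : LowerIngham lam L S)
    (j : K) : LowerIngham lam L (insert j S) := by
  classical
  intro a b hab
  have hba : a < b := by linarith
  set δ : ℝ := (b - a - L) / 4 with hδ'
  have hδ : 0 < δ := by
    rw [hδ']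
    linarith
  obtain ⟨A, hA, hlow⟩ := hS (a + δ) (b - δ) (by linarith)
  obtain ⟨B, hB, hup⟩ := exists_integral_norm_expSum_sq_le hγ hgap hba.le
  obtain ⟨ε, hε, hsinc⟩ := exists_pos_le_one_sub_sinc (x₀ := γ * δ) (by positivity)
  set C : ℝ := (2 + (b - a) / δ) / (A * ε ^ 2) with hC
  have hC0 : 0 < C := by
    have := sub_pos.2 hba
    positivity
  set D : ℝ := C + (2 + 2 * B * C) / (b - a) with hD
  have hD0 : 0 < D := by
    have := sub_pos.2 hba
    positivity
  refine ⟨D⁻¹, inv_pos.2 hD0, fun s hs c => ?_⟩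
  set F : ℝ := ∫ t in a..b, ‖expSum lam s c t‖ ^ 2 with hF
  have hF0 : 0 ≤ F := intervalIntegral.integral_nonneg hba.le fun t _ => by positivity
  rw [inv_mul_le_iff₀ hD0]
  have herase : (↑(s.erase j) : Set K) ⊆ S := fun k hk => by
    rw [Finset.mem_coe, Finset.mem_erase] at hk
    exact (hs hk.2).resolve_left hk.1
  have hrest : ∑ k ∈ s.erase j, ‖c k‖ ^ 2 ≤ C * F := by
    set d : K → ℂ := fun k => c k * ((1 - Real.sinc ((lam k - lam j) * δ) : ℝ) : ℂ) with hd
    have hdj : expSum lam s d = expSum lam (s.erase j) d := by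
      ext t
      refine (Finset.sum_erase s ?_).symm
      simp [hd]
    have h1 := integral_norm_average_sub_sq_le (lam := lam) s c (lam j) hδ
      (show a + δ ≤ b - δ by linarith)
    rw [← hd, hdj, ← hF] at h1
    have h2 := hlow (s.erase j) herase d
    have h3 : ε ^ 2 * ∑ k ∈ s.erase j, ‖c k‖ ^ 2 ≤ ∑ k ∈ s.erase j, ‖d k‖ ^ 2 := by
      rw [Finset.mul_sum]
      refine Finset.sum_le_sum fun k hk => ?_
      have h4 : ε ≤ 1 - Real.sinc ((lam k - lam j) * δ) := by
        refine hsinc _ ?_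
        rw [abs_mul, abs_of_pos hδ]
        gcongr
        exact hgap k j (Finset.ne_of_mem_erase hk)
      rw [hd, norm_mul, Complex.norm_real, Real.norm_of_nonneg (hε.le.trans h4), mul_pow,
        mul_comm]
      gcongr
    rw [hC, div_mul_eq_mul_div, le_div_iff₀ (by positivity)]
    have h5 := mul_le_mul_of_nonneg_left h3 hA.le
    linarith
  have hrest' : ∫ t in a..b, ‖expSum lam (s.erase j) c t‖ ^ 2 ≤ B * (C * F) :=
    (hup _ c).trans (by gcongr)
  by_cases hj : j ∈ s
  · have hcj : (b - a) * ‖c j‖ ^ 2 ≤ 2 * F + 2 * (B * (C * F)) := by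
      calc (b - a) * ‖c j‖ ^ 2 = ∫ t in a..b, ‖c j‖ ^ 2 := by simp
        _ ≤ ∫ t in a..b, (2 * ‖expSum lam s c t‖ ^ 2 +
              2 * ‖expSum lam (s.erase j) c t‖ ^ 2) := by
          refine intervalIntegral.integral_mono_on hba.le (by simp)
            (by apply Continuous.intervalIntegrable; fun_prop) fun t _ => ?_
          have h1 : c j * Complex.exp (Complex.I * (lam j : ℂ) * (t : ℂ)) =
              expSum lam s c t - expSum lam (s.erase j) c t := by
            unfold expSum
            rw [← Finset.sum_erase_add s _ hj]
            ring
          have h2 : ‖c j‖ ≤ ‖expSum lam s c t‖ + ‖expSum lam (s.erase j) c t‖ := by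
            refine le_trans (le_of_eq ?_) (norm_sub_le _ _)
            rw [← h1, norm_mul, norm_exp_I_mul_mul, mul_one]
          calc ‖c j‖ ^ 2 ≤ (‖expSum lam s c t‖ + ‖expSum lam (s.erase j) c t‖) ^ 2 := by gcongr
            _ ≤ 2 * (‖expSum lam s c t‖ ^ 2 + ‖expSum lam (s.erase j) c t‖ ^ 2) := add_sq_le
            _ = _ := by ring
        _ = 2 * F + 2 * ∫ t in a..b, ‖expSum lam (s.erase j) c t‖ ^ 2 := by
          rw [intervalIntegral.integral_add (by apply Continuous.intervalIntegrable; fun_prop)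
            (by apply Continuous.intervalIntegrable; fun_prop),
            intervalIntegral.integral_const_mul, intervalIntegral.integral_const_mul]
        _ ≤ _ := by gcongr
    rw [← Finset.sum_erase_add s _ hj]
    have hcj' : ‖c j‖ ^ 2 ≤ (2 + 2 * B * C) / (b - a) * F := by
      rw [div_mul_eq_mul_div, le_div_iff₀ (sub_pos.2 hba)]
      linarith
    rw [hD, add_mul]
    exact add_le_add hrest hcj'
  · rw [Finset.erase_eq_of_notMem hj] at hrest
    refine hrest.trans ?_
    have := sub_pos.2 hba
    gcongr
    rw [hD, le_add_iff_nonneg_right]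
    positivity

end

/-- Ingham-type theorem: if the family of exponents `λ` satisfies a uniform gap
condition, and outside a finite set `A₀` a gap condition with constant `γ₀ > 0`,
then for any interval of length `> 2π/γ₀` there are constants `0 < A, B` such
that `A Σ|c_k|² ≤ ∫_I |Σ c_k e^{iλ_k t}|² dt ≤ B Σ|c_k|²` for all finitely
supported coefficient families. -/
theorem ingham_type {K : Type*} [Countable K] (lam : K → ℝ)
    (hgap : ∃ γ > 0, ∀ k n : K, k ≠ n → γ ≤ |lam k - lam n|)
    (A₀ : Finset K) (γ₀ : ℝ) (hγ₀ : 0 < γ₀)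
    (hgap' : ∀ k n : K, k ∉ A₀ → n ∉ A₀ → k ≠ n → γ₀ ≤ |lam k - lam n|)
    (a b : ℝ) (hI : 2 * Real.pi / γ₀ < b - a) :
    ∃ A > (0 : ℝ), ∃ B > (0 : ℝ), ∀ c : K →₀ ℂ,
      (A * ∑ k ∈ c.support, ‖c k‖ ^ 2 ≤
        ∫ t in Set.Ioo a b,
          ‖∑ k ∈ c.support, c k * Complex.exp (Complex.I * (lam k : ℂ) * (t : ℂ))‖ ^ 2) ∧
      (∫ t in Set.Ioo a b,
          ‖∑ k ∈ c.support, c k * Complex.exp (Complex.I * (lam k : ℂ) * (t : ℂ))‖ ^ 2 ≤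
        B * ∑ k ∈ c.support, ‖c k‖ ^ 2) := by
  obtain ⟨γ, hγ, hgap⟩ := hgap
  have hL : 0 ≤ 2 * Real.pi / γ₀ := by positivity
  have hab : a ≤ b := by linarith
  have hlow : ∀ R : Finset K, LowerIngham lam (2 * Real.pi / γ₀) ((↑A₀ : Set K)ᶜ ∪ ↑R) := by
    classical
    intro R
    induction R using Finset.induction with
    | empty =>
      intro p q hpq
      rw [Finset.coe_empty, Set.union_empty]
      exact exists_le_integral_norm_expSum_sq hγ₀
        (fun k hk n hn => hgap' k n (by simpa using hk) (by simpa using hn)) hpq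
    | insert j R _ ih =>
      rw [Finset.coe_insert, Set.union_insert]
      exact ih.insert hγ hL hgap j
  obtain ⟨A, hA, hAle⟩ := hlow A₀ a b hI
  obtain ⟨B, hB, hBle⟩ := exists_integral_norm_expSum_sq_le hγ hgap hab
  refine ⟨A, hA, B, hB, fun c => ?_⟩
  rw [← integral_Ioc_eq_integral_Ioo, ← intervalIntegral.integral_of_le hab]
  exact ⟨hAle c.support (by simp) c, hBle c.support c⟩
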